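/- arXiv:2102.09074 — 2 statements merged into one kernel-verified Lean document; each statement's English description precedes it below -/
import Mathlib

section
/- Let ι = α ⊕ β with parity matrix S, let κ be a finite type, and let E : κ → Matrix ι ι ℂ be a family of parity-definite matrices with ∑ k, (E k)ᴴ * E k = 1. Then there exist a parity-graded finite type ι_E = α_E ⊕ β_E with parity matrix S_E, a unit vector ψ : ι_E → ℂ with S_E.mulVec ψ = ψ, and a unitary matrix U : Matrix (ι × ι_E) (ι × ι_E) ℂ commuting with the Kronecker product S ⊗ S_E, such that for every parity-preserving ρ : Matrix ι ι ℂ and all x x' : ι, (∑ k, E k * ρ * (E k)ᴴ) x x' = ∑ y, (U * (ρ ⊗ |ψ⟩⟨ψ|) * Uᴴ) (x,y) (x',y), where |ψ⟩⟨ψ| has entries ψ y * conj (ψ y'). -/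
open scoped Matrix Kronecker ComplexConjugate

/-- The parity matrix on `α ⊕ β`: diagonal with `+1` on `α` and `-1` on `β`. -/
noncomputable def parityMatrix (α β : Type*) [DecidableEq α] [DecidableEq β] :
    Matrix (α ⊕ β) (α ⊕ β) ℂ :=
  Matrix.diagonal (Sum.elim (fun _ => (1 : ℂ)) (fun _ => (-1 : ℂ)))

/-- The matrix of `v ↦ M v ⊗ e_a`, sending the system into the slice of the composite system
labelled by the environment basis vector `a`. -/
def Matrix.tensorBasis {ι ε : Type*} [DecidableEq ε] (M : Matrix ι ι ℂ) (a : ε) :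
    Matrix (ι × ε) ι ℂ :=
  Matrix.of fun p x => if p.2 = a then M p.1 x else 0

namespace Matrix

variable {ι ε : Type*} [Fintype ι] [DecidableEq ε]

theorem tensorBasis_mul (M N : Matrix ι ι ℂ) (a : ε) :
    tensorBasis M a * N = tensorBasis (M * N) a := by
  ext ⟨x, y⟩ x'
  by_cases h : y = a <;> simp [tensorBasis, mul_apply, h]

theorem conjTranspose_tensorBasis_mul [Fintype ε] (M N : Matrix ι ι ℂ) (a b : ε) :
    (tensorBasis M a)ᴴ * tensorBasis N b = if a = b then Mᴴ * N else 0 := by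
  ext x x'
  by_cases h : a = b
  · subst h
    simp [tensorBasis, mul_apply, Fintype.sum_prod_type, apply_ite]
  · have h' : ∀ y : ε, y = b → y ≠ a := fun y hb ha => h (ha.symm.trans hb)
    simp only [mul_apply, if_neg h, zero_apply]
    refine Finset.sum_eq_zero fun p _ => ?_
    by_cases hb : p.2 = b
    · simp [tensorBasis, h' _ hb]
    · simp [tensorBasis, hb]

theorem kronecker_diagonal_mul_tensorBasis [Fintype ε] (S M : Matrix ι ι ℂ) (d : ε → ℂ) (a : ε) :
    (S ⊗ₖ diagonal d) * tensorBasis M a = d a • tensorBasis (S * M) a := by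
  ext ⟨x, y⟩ x'
  by_cases h : y = a
  · subst h
    simp [tensorBasis, mul_apply, Fintype.sum_prod_type, kroneckerMap_apply, Finset.mul_sum,
      mul_left_comm, mul_comm]
  · simp [tensorBasis, mul_apply, Fintype.sum_prod_type, kroneckerMap_apply, h, diagonal_apply]

theorem sum_tensorBasis_mul_conjTranspose [Fintype ε] (M N : Matrix ι ι ℂ) (a b : ε) (x x' : ι) :
    ∑ y, (tensorBasis M a * (tensorBasis N b)ᴴ) (x, y) (x', y) =
      if a = b then (M * Nᴴ) x x' else 0 := by
  by_cases h : a = b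
  · subst h
    simp only [tensorBasis, mul_apply, conjTranspose_apply, of_apply, if_true]
    rw [Finset.sum_eq_single a] <;> simp +contextual
  · rw [if_neg h]
    refine Finset.sum_eq_zero fun y _ => ?_
    by_cases ha : y = a
    · have hb : y ≠ b := fun hb => h (ha.symm.trans hb)
      simp [tensorBasis, mul_apply, hb]
    · simp [tensorBasis, mul_apply, ha]

end Matrix

section IsometrySwap

variable {m n : Type*} [Fintype m] [Fintype n] [DecidableEq m] [DecidableEq n]

namespace Matrix

/-- The operator exchanging the ranges of `J` and `V` and fixing the orthogonal complement of both,
when `J` and `V` are isometries with orthogonal ranges. -/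
def isometrySwap (J V : Matrix m n ℂ) : Matrix m m ℂ :=
  1 - J * Jᴴ - V * Vᴴ + V * Jᴴ + J * Vᴴ

variable {J V : Matrix m n ℂ}

omit [Fintype m] [DecidableEq n] in
theorem conjTranspose_isometrySwap : (isometrySwap J V)ᴴ = isometrySwap J V := by
  simp only [isometrySwap, conjTranspose_add, conjTranspose_sub, conjTranspose_mul,
    conjTranspose_conjTranspose, conjTranspose_one]
  abel

theorem isometrySwap_mul_left (hJ : Jᴴ * J = 1) (hVJ : Vᴴ * J = 0) :
    isometrySwap J V * J = V := by
  simp [isometrySwap, Matrix.add_mul, Matrix.sub_mul, Matrix.mul_assoc, hJ, hVJ]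

theorem isometrySwap_mul_right (hV : Vᴴ * V = 1) (hJV : Jᴴ * V = 0) :
    isometrySwap J V * V = J := by
  simp [isometrySwap, Matrix.add_mul, Matrix.sub_mul, Matrix.mul_assoc, hV, hJV]

theorem isometrySwap_mem_unitaryGroup (hJ : Jᴴ * J = 1) (hV : Vᴴ * V = 1) (hVJ : Vᴴ * J = 0) :
    isometrySwap J V ∈ unitaryGroup m ℂ := by
  have hJV : Jᴴ * V = 0 := by simpa using congrArg conjTranspose hVJ
  rw [mem_unitaryGroup_iff, star_eq_conjTranspose, conjTranspose_isometrySwap]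
  have h : isometrySwap J V * (1 - J * Jᴴ - V * Vᴴ + V * Jᴴ + J * Vᴴ) = 1 := by
    simp only [Matrix.mul_add, Matrix.mul_sub, ← Matrix.mul_assoc, isometrySwap_mul_left hJ hVJ,
      isometrySwap_mul_right hV hJV, mul_one]
    rw [isometrySwap]
    abel
  exact h

omit [DecidableEq n] in
theorem isometrySwap_commute {P : Matrix m m ℂ} {S : Matrix n n ℂ} (hP : Pᴴ = P) (hS : Sᴴ = S)
    (hJ : P * J = J * S) (hV : P * V = V * S) :
    isometrySwap J V * P = P * isometrySwap J V := by
  have hJ' : Jᴴ * P = S * Jᴴ := by simpa [hP, hS] using congrArg conjTranspose hJ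
  have hV' : Vᴴ * P = S * Vᴴ := by simpa [hP, hS] using congrArg conjTranspose hV
  simp only [isometrySwap, Matrix.mul_add, Matrix.mul_sub, Matrix.add_mul,
    Matrix.sub_mul, Matrix.mul_assoc, hJ', hV', Matrix.one_mul, Matrix.mul_one]
  simp only [← Matrix.mul_assoc, hJ, hV]

end Matrix

end IsometrySwap

section ParityMatrix

variable (α β : Type*) [DecidableEq α] [DecidableEq β]

theorem conjTranspose_parityMatrix : (parityMatrix α β)ᴴ = parityMatrix α β := by
  rw [parityMatrix, Matrix.diagonal_conjTranspose]
  congr 1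
  ext (_ | _) <;> simp

theorem parityMatrix_mul_self [Fintype α] [Fintype β] :
    parityMatrix α β * parityMatrix α β = 1 := by
  rw [parityMatrix, Matrix.diagonal_mul_diagonal, ← Matrix.diagonal_one]
  congr 1
  ext (_ | _) <;> simp

end ParityMatrix

/-- Kraus form to Stinespring dilation: an operator-sum representation with parity-definite
Kraus operators summing to the identity can be realized by a parity-respecting unitary on the
system together with a parity-graded environment in an even pure state, followed by the
partial trace over the environment. -/
theorem kraus_to_stinespring
    {α β : Type*} [Fintype α] [Fintype β] [DecidableEq α] [DecidableEq β]
    {κ : Type*} [Fintype κ]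
    (E : κ → Matrix (α ⊕ β) (α ⊕ β) ℂ)
    (hdef : ∀ k, parityMatrix α β * E k * parityMatrix α β = E k ∨
      parityMatrix α β * E k * parityMatrix α β = -(E k))
    (hsum : (∑ k, (E k)ᴴ * E k) = 1) :
    ∃ (nE mE : ℕ) (ψ : (Fin nE ⊕ Fin mE) → ℂ)
      (U : Matrix ((α ⊕ β) × (Fin nE ⊕ Fin mE)) ((α ⊕ β) × (Fin nE ⊕ Fin mE)) ℂ),
      (∑ y, ‖ψ y‖ ^ 2 = 1) ∧
      (parityMatrix (Fin nE) (Fin mE)).mulVec ψ = ψ ∧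
      U ∈ Matrix.unitaryGroup ((α ⊕ β) × (Fin nE ⊕ Fin mE)) ℂ ∧
      U * (parityMatrix α β ⊗ₖ parityMatrix (Fin nE) (Fin mE)) =
        (parityMatrix α β ⊗ₖ parityMatrix (Fin nE) (Fin mE)) * U ∧
      ∀ ρ : Matrix (α ⊕ β) (α ⊕ β) ℂ,
        parityMatrix α β * ρ * parityMatrix α β = ρ →
        ∀ x x', (∑ k, E k * ρ * (E k)ᴴ) x x' =
          ∑ y, (U * (ρ ⊗ₖ Matrix.of fun a b => ψ a * conj (ψ b)) * Uᴴ) (x, y) (x', y) := by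
  classical
  set S := parityMatrix α β with hS
  set n := Fintype.card κ
  let e := Fintype.equivFin κ
  let d : Fin (n + 1) ⊕ Fin n → ℂ := Sum.elim (fun _ => 1) (fun _ => -1)
  let f : κ → Fin (n + 1) ⊕ Fin n := fun k =>
    if S * E k * S = E k then Sum.inl (e k).succ else Sum.inr (e k)
  let o : Fin (n + 1) ⊕ Fin n := Sum.inl 0
  have hf : Function.Injective f := by
    intro k l h
    simp only [f] at h
    split_ifs at h <;> simpa using h
  have hfo : ∀ k, f k ≠ o := by
    intro k
    simp only [f, o]
    split_ifs <;> simp [Fin.succ_ne_zero]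
  have hSS : S * S = 1 := parityMatrix_mul_self α β
  have hSE : ∀ k, d (f k) • (S * E k) = E k * S := by
    intro k
    have key : S * (S * E k * S) = E k * S := by
      rw [← Matrix.mul_assoc, ← Matrix.mul_assoc, hSS, Matrix.one_mul]
    by_cases h : S * E k * S = E k
    · rw [h] at key
      have hk : f k = Sum.inl (e k).succ := if_pos h
      simpa [hk, d] using key
    · rw [(hdef k).resolve_left h] at key
      simpa [f, d, h] using key
  let J := Matrix.tensorBasis (1 : Matrix (α ⊕ β) (α ⊕ β) ℂ) o
  let V := ∑ k, Matrix.tensorBasis (E k) (f k)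
  have hJ : Jᴴ * J = 1 := by simp [J, Matrix.conjTranspose_tensorBasis_mul]
  have hV : Vᴴ * V = 1 := by
    simp only [V, Matrix.conjTranspose_sum, Matrix.sum_mul, Matrix.mul_sum,
      Matrix.conjTranspose_tensorBasis_mul, hf.eq_iff]
    simpa using hsum
  have hVJ : Vᴴ * J = 0 := by
    simp [V, J, Matrix.conjTranspose_sum, Matrix.sum_mul, Matrix.conjTranspose_tensorBasis_mul, hfo]
  refine ⟨n + 1, n, Pi.single o 1, Matrix.isometrySwap J V, ?_, ?_,
    Matrix.isometrySwap_mem_unitaryGroup hJ hV hVJ, ?_, ?_⟩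
  · rw [Finset.sum_eq_single o] <;> simp +contextual
  · ext y
    rw [parityMatrix, Matrix.mulVec_diagonal]
    by_cases h : y = o
    · subst h
      simp [o]
    · simp [h]
  · refine Matrix.isometrySwap_commute (S := S) ?_ (conjTranspose_parityMatrix α β) ?_ ?_
    · rw [Matrix.conjTranspose_kronecker, hS, conjTranspose_parityMatrix,
        conjTranspose_parityMatrix]
    · change (S ⊗ₖ Matrix.diagonal d) * J = J * S
      simp [J, Matrix.kronecker_diagonal_mul_tensorBasis, Matrix.tensorBasis_mul, d, o]
    · change (S ⊗ₖ Matrix.diagonal d) * V = V * S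
      simp only [V, Matrix.mul_sum, Matrix.sum_mul, Matrix.kronecker_diagonal_mul_tensorBasis,
        Matrix.tensorBasis_mul, ← hSE]
      refine Finset.sum_congr rfl fun k _ => ?_
      ext p x
      simp [Matrix.tensorBasis]
  · intro ρ _ x x'
    have hρ : (ρ ⊗ₖ Matrix.of fun a b =>
        (Pi.single o 1 : _ → ℂ) a * conj ((Pi.single o 1 : _ → ℂ) b)) = J * ρ * Jᴴ := by
      ext ⟨a, y⟩ ⟨b, z⟩
      simp only [J, Matrix.tensorBasis_mul, Matrix.one_mul]
      by_cases hy : y = o <;> by_cases hz : z = o <;>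
        simp [Matrix.tensorBasis, Matrix.mul_apply, Matrix.one_apply, hy, hz, apply_ite]
    have hU : Matrix.isometrySwap J V * (J * ρ * Jᴴ) * (Matrix.isometrySwap J V)ᴴ =
        V * ρ * Vᴴ := by
      have h := Matrix.isometrySwap_mul_left hJ hVJ
      calc _ = (Matrix.isometrySwap J V * J) * ρ * (Matrix.isometrySwap J V * J)ᴴ := by
            simp only [Matrix.conjTranspose_mul, Matrix.mul_assoc]
        _ = _ := by rw [h]
    rw [hρ, hU]
    simp only [V, Matrix.conjTranspose_sum, Matrix.sum_mul, Matrix.mul_sum, Matrix.tensorBasis_mul,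
      Matrix.sum_apply]
    rw [Finset.sum_comm]
    refine Finset.sum_congr rfl fun k _ => ?_
    rw [Finset.sum_comm]
    simp [Matrix.sum_tensorBasis_mul_conjTranspose, hf.eq_iff]
end

section
/- Let w : ι₁ × ι₂ → ℂ be a unit vector with (S₁ ⊗ S₂).mulVec w = ε • w for some ε ∈ ({1, −1} : Set ℂ), let ρ : Matrix (ι₁ × ι₂) (ι₁ × ι₂) ℂ be the rank-one projection ρ z z' = w z * conj (w z'), and let ρ_A, ρ_B be its partial traces, ρ_A x x' = ∑ y, ρ (x,y) (x',y) and ρ_B y y' = ∑ x, ρ (x,y) (x,y'). Suppose that for every Hermitian parity-preserving O_A : Matrix ι₁ ι₁ ℂ (S₁ * O_A * S₁ = O_A) and every Hermitian parity-preserving O_B : Matrix ι₂ ι₂ ℂ, the trace of ρ * (O_A ⊗ O_B) equals (trace of ρ_A * O_A) * (trace of ρ_B * O_B). Then there exist unit vectors u : ι₁ → ℂ and v : ι₂ → ℂ, each a parity eigenvector of the corresponding parity matrix, such that w (x, y) = u x * v y for all x y. -/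
open scoped Matrix Kronecker ComplexConjugate

/-- A linear functional that vanishes on the Hermitian matrices fixed by conjugation with a Hermitian
`S` vanishes on all matrices fixed by this conjugation. -/
theorem eq_zero_of_eq_zero_on_hermitian {ι : Type*} [Fintype ι] (S : Matrix ι ι ℂ) (hS : Sᴴ = S)
    (g : Matrix ι ι ℂ →ₗ[ℂ] ℂ) (h : ∀ A, Aᴴ = A → S * A * S = A → g A = 0)
    (A : Matrix ι ι ℂ) (hA : S * A * S = A) : g A = 0 := by
  have hAH : S * Aᴴ * S = Aᴴ := by
    conv_rhs => rw [← hA]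
    simp only [Matrix.conjTranspose_mul, hS, Matrix.mul_assoc]
  have h1 := h (A + Aᴴ) (by simp [add_comm])
    (by rw [Matrix.mul_add, Matrix.add_mul, hA, hAH])
  have h2 := h (Complex.I • (A - Aᴴ))
    (by simp [Matrix.conjTranspose_smul, Matrix.conjTranspose_sub, ← smul_neg])
    (by rw [Matrix.mul_smul, Matrix.smul_mul, Matrix.mul_sub, Matrix.sub_mul, hA, hAH])
  rw [map_add] at h1
  rw [map_smul, map_sub, smul_eq_mul] at h2
  have h3 := (mul_eq_zero.mp h2).resolve_left Complex.I_ne_zero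
  linear_combination (h1 + h3) / 2

/-- Factorization of expectation values on Hermitian parity-preserving local observables extends
to all parity-preserving local operators. -/
theorem trace_kronecker_factorizes_of_hermitian {ι κ : Type*} [Fintype ι] [Fintype κ]
    (S : Matrix ι ι ℂ) (T : Matrix κ κ ℂ) (hS : Sᴴ = S) (hT : Tᴴ = T)
    (ρ : Matrix (ι × κ) (ι × κ) ℂ) (ρA : Matrix ι ι ℂ) (ρB : Matrix κ κ ℂ)
    (h : ∀ A B, Aᴴ = A → S * A * S = A → Bᴴ = B → T * B * T = B →
      (ρ * (A ⊗ₖ B)).trace = (ρA * A).trace * (ρB * B).trace)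
    (A : Matrix ι ι ℂ) (B : Matrix κ κ ℂ) (hA : S * A * S = A) (hB : T * B * T = B) :
    (ρ * (A ⊗ₖ B)).trace = (ρA * A).trace * (ρB * B).trace := by
  let G : Matrix ι ι ℂ →ₗ[ℂ] Matrix κ κ ℂ →ₗ[ℂ] ℂ := LinearMap.mk₂ ℂ
    (fun A B => (ρ * (A ⊗ₖ B)).trace - (ρA * A).trace * (ρB * B).trace)
    (fun _ _ _ => by
      simp only [Matrix.add_kronecker, Matrix.mul_add, Matrix.trace_add]; ring)
    (fun _ _ _ => by
      simp only [Matrix.smul_kronecker, Matrix.mul_smul, Matrix.trace_smul, smul_eq_mul]; ring)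
    (fun _ _ _ => by
      simp only [Matrix.kronecker_add, Matrix.mul_add, Matrix.trace_add]; ring)
    (fun _ _ _ => by
      simp only [Matrix.kronecker_smul, Matrix.mul_smul, Matrix.trace_smul, smul_eq_mul]; ring)
  refine sub_eq_zero.mp (eq_zero_of_eq_zero_on_hermitian S hS (G.flip B) (fun A hAH hA => ?_) A hA)
  exact eq_zero_of_eq_zero_on_hermitian T hT (G A)
    (fun B hBH hB => sub_eq_zero.mpr (h A B hAH hA hBH hB)) B hB

/-- A unit vector which is a product is a product of unit vectors proportional to the factors. -/
theorem exists_unit_factors {ι κ : Type*} [Fintype ι] [Fintype κ] (w : ι × κ → ℂ)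
    (hw : ∑ z, ‖w z‖ ^ 2 = 1) (f : ι → ℂ) (g : κ → ℂ) (h : ∀ x y, w (x, y) = f x * g y) :
    ∃ c d : ℂ, ∑ x, ‖c * f x‖ ^ 2 = 1 ∧ ∑ y, ‖d * g y‖ ^ 2 = 1 ∧
      ∀ x y, w (x, y) = (c * f x) * (d * g y) := by
  set F := ∑ x, ‖f x‖ ^ 2 with hF
  set K := ∑ y, ‖g y‖ ^ 2 with hK
  have hFK : F * K = 1 := by
    rw [← hw, hF, hK, Fintype.sum_mul_sum, Fintype.sum_prod_type]
    simp [h, mul_pow]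
  have hF0 : 0 < F := lt_of_le_of_ne (by positivity) (by rintro h0; simp [← h0] at hFK)
  have hs : √F ≠ 0 := (Real.sqrt_pos.mpr hF0).ne'
  refine ⟨((√F)⁻¹ : ℝ), (√F : ℝ), ?_, ?_, fun x y => ?_⟩
  · simp only [norm_mul, mul_pow, Complex.norm_real, Real.norm_eq_abs, sq_abs, inv_pow,
      Real.sq_sqrt hF0.le]
    rw [← Finset.mul_sum, ← hF, inv_mul_cancel₀ hF0.ne']
  · simp only [norm_mul, mul_pow, Complex.norm_real, Real.norm_eq_abs, sq_abs,
      Real.sq_sqrt hF0.le]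
    rw [← Finset.mul_sum, ← hK, hFK]
  · have hs' : ((√F : ℝ) : ℂ) ≠ 0 := by exact_mod_cast hs
    rw [h]
    push_cast
    field_simp

/-- The parity sign: `+1` on `α` and `-1` on `β`. -/
noncomputable def paritySign (α β : Type*) : α ⊕ β → ℂ :=
  Sum.elim (fun _ => (1 : ℂ)) (fun _ => (-1 : ℂ))

theorem paritySign_eq_or {α β : Type*} (x : α ⊕ β) :
    paritySign α β x = 1 ∨ paritySign α β x = -1 := by
  cases x <;> simp [paritySign]

theorem parityMatrix_eq_diagonal (α β : Type*) [DecidableEq α] [DecidableEq β] :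
    parityMatrix α β = Matrix.diagonal (paritySign α β) := rfl

theorem parityMatrix_conjTranspose (α β : Type*) [DecidableEq α] [DecidableEq β] :
    (parityMatrix α β)ᴴ = parityMatrix α β := by
  rw [parityMatrix_eq_diagonal, Matrix.diagonal_conjTranspose]
  congr 1
  ext x
  rcases paritySign_eq_or x with h | h <;> simp [h]

theorem parityMatrix_conj_single {α β : Type*} [Fintype α] [Fintype β] [DecidableEq α]
    [DecidableEq β] (x x' : α ⊕ β) (h : paritySign α β x = paritySign α β x') :
    parityMatrix α β * Matrix.single x x' (1 : ℂ) * parityMatrix α β = Matrix.single x x' 1 := by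
  rw [parityMatrix_eq_diagonal]
  ext i j
  rw [Matrix.mul_diagonal, Matrix.diagonal_mul]
  by_cases hij : x = i ∧ x' = j
  · obtain ⟨rfl, rfl⟩ := hij
    rcases paritySign_eq_or x' with h' | h' <;> simp [h, h']
  · simp [Matrix.single_apply_of_ne _ _ _ _ _ hij]

/-- A vector supported on one parity sector is a parity eigenvector. -/
theorem parityMatrix_mulVec_eq_or {α β : Type*} [Fintype α] [Fintype β] [DecidableEq α]
    [DecidableEq β] (u : α ⊕ β → ℂ) (x₀ : α ⊕ β)
    (hu : ∀ x, paritySign α β x ≠ paritySign α β x₀ → u x = 0) :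
    (parityMatrix α β).mulVec u = u ∨ (parityMatrix α β).mulVec u = -u := by
  have key : (parityMatrix α β).mulVec u = paritySign α β x₀ • u := by
    ext x
    rw [parityMatrix_eq_diagonal, Matrix.mulVec_diagonal, Pi.smul_apply, smul_eq_mul]
    by_cases hx : paritySign α β x = paritySign α β x₀
    · rw [hx]
    · rw [hu x hx, mul_zero, mul_zero]
  rcases paritySign_eq_or x₀ with h | h <;> simp [key, h]

/-- A pure bipartite fermionic state obeying the parity super-selection rule whose expectation
values factorize on all parity-respecting local Hermitian observables is a product of two
parity-eigenvector unit vectors. -/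
theorem pure_uncorrelated_is_product
    {α₁ β₁ α₂ β₂ : Type*} [Fintype α₁] [Fintype β₁] [Fintype α₂] [Fintype β₂]
    [DecidableEq α₁] [DecidableEq β₁] [DecidableEq α₂] [DecidableEq β₂]
    (w : ((α₁ ⊕ β₁) × (α₂ ⊕ β₂)) → ℂ)
    (hw_unit : ∑ z, ‖w z‖ ^ 2 = 1)
    (ε : ℂ) (hε : ε ∈ ({1, -1} : Set ℂ))
    (hw_par : (parityMatrix α₁ β₁ ⊗ₖ parityMatrix α₂ β₂).mulVec w = ε • w)
    (ρ : Matrix ((α₁ ⊕ β₁) × (α₂ ⊕ β₂)) ((α₁ ⊕ β₁) × (α₂ ⊕ β₂)) ℂ)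
    (hρ : ∀ z z', ρ z z' = w z * conj (w z'))
    (ρA : Matrix (α₁ ⊕ β₁) (α₁ ⊕ β₁) ℂ)
    (hρA : ∀ x x', ρA x x' = ∑ y, ρ (x, y) (x', y))
    (ρB : Matrix (α₂ ⊕ β₂) (α₂ ⊕ β₂) ℂ)
    (hρB : ∀ y y', ρB y y' = ∑ x, ρ (x, y) (x, y'))
    (hfact : ∀ (OA : Matrix (α₁ ⊕ β₁) (α₁ ⊕ β₁) ℂ) (OB : Matrix (α₂ ⊕ β₂) (α₂ ⊕ β₂) ℂ),
      OAᴴ = OA → parityMatrix α₁ β₁ * OA * parityMatrix α₁ β₁ = OA →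
      OBᴴ = OB → parityMatrix α₂ β₂ * OB * parityMatrix α₂ β₂ = OB →
      (ρ * (OA ⊗ₖ OB)).trace = (ρA * OA).trace * (ρB * OB).trace) :
    ∃ (u : (α₁ ⊕ β₁) → ℂ) (v : (α₂ ⊕ β₂) → ℂ),
      (∑ x, ‖u x‖ ^ 2 = 1) ∧ (∑ y, ‖v y‖ ^ 2 = 1) ∧
      ((parityMatrix α₁ β₁).mulVec u = u ∨ (parityMatrix α₁ β₁).mulVec u = -u) ∧
      ((parityMatrix α₂ β₂).mulVec v = v ∨ (parityMatrix α₂ β₂).mulVec v = -v) ∧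
      (∀ x y, w (x, y) = u x * v y) := by
  let s := paritySign α₁ β₁
  let t := paritySign α₂ β₂
  have hpar : ∀ x y, s x * t y * w (x, y) = ε * w (x, y) := fun x y => by
    have := congrFun hw_par (x, y)
    rwa [parityMatrix_eq_diagonal, parityMatrix_eq_diagonal, Matrix.diagonal_kronecker_diagonal,
      Matrix.mulVec_diagonal] at this
  have hent : ∀ x x' y y', s x = s x' → t y = t y' →
      w (x, y) * conj (w (x', y')) = ρA x x' * ρB y y' := fun x x' y y' hx hy => by
    have := trace_kronecker_factorizes_of_hermitian _ _ (parityMatrix_conjTranspose α₁ β₁)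
      (parityMatrix_conjTranspose α₂ β₂) ρ ρA ρB
      (fun A B h₁ h₂ h₃ h₄ => hfact A B h₁ h₂ h₃ h₄) _ _
      (parityMatrix_conj_single x' x hx.symm) (parityMatrix_conj_single y' y hy.symm)
    simpa [Matrix.single_kronecker_single, Matrix.trace_mul_single, hρ] using this
  obtain ⟨⟨x₀, y₀⟩, h₀⟩ : ∃ z, w z ≠ 0 := by
    by_contra! hz
    simp [hz] at hw_unit
  have hst : ∀ {x y}, w (x, y) ≠ 0 → s x * t y = ε := fun h => mul_right_cancel₀ h (hpar _ _)
  have ht0 : ∀ y, t y ≠ 0 := fun y => by rcases paritySign_eq_or y with h | h <;> simp [t, h]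
  have hs0 : ∀ x, s x ≠ 0 := fun x => by rcases paritySign_eq_or x with h | h <;> simp [s, h]
  have hdiag : ∀ {x y}, w (x, y) ≠ 0 → ρA x x * ρB y y ≠ 0 := fun {x y} h => by
    rw [← hent x x y y rfl rfl]
    exact mul_ne_zero h ((map_ne_zero _).mpr h)
  have hsupp : ∀ {x y}, w (x, y) ≠ 0 → s x = s x₀ ∧ t y = t y₀ := fun {x y} h => by
    have hcross : w (x₀, y) ≠ 0 := fun hz => by
      have := hent x₀ x₀ y y rfl rfl
      rw [hz, zero_mul] at this
      exact mul_ne_zero (left_ne_zero_of_mul (hdiag h₀)) (right_ne_zero_of_mul (hdiag h)) this.symm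
    exact ⟨mul_right_cancel₀ (ht0 y) ((hst h).trans (hst hcross).symm),
      mul_left_cancel₀ (hs0 x₀) ((hst hcross).trans (hst h₀).symm)⟩
  have hA0 : ∀ x, s x ≠ s x₀ → ρA x x₀ = 0 := fun x hx => by
    rw [hρA]
    refine Finset.sum_eq_zero fun y _ => ?_
    rw [hρ, not_not.mp fun h => hx (hsupp (y := y) h).1, zero_mul]
  have hB0 : ∀ y, t y ≠ t y₀ → ρB y y₀ = 0 := fun y hy => by
    rw [hρB]
    refine Finset.sum_eq_zero fun x _ => ?_
    rw [hρ, not_not.mp fun h => hy (hsupp (x := x) h).2, zero_mul]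
  have hc : conj (w (x₀, y₀)) ≠ 0 := (map_ne_zero _).mpr h₀
  have hprod : ∀ x y, w (x, y) = ρA x x₀ * (ρB y y₀ / conj (w (x₀, y₀))) := fun x y => by
    rw [← mul_div_assoc, eq_div_iff hc]
    by_cases hx : s x = s x₀
    · by_cases hy : t y = t y₀
      · exact hent x x₀ y y₀ hx hy
      · rw [hB0 y hy, not_not.mp fun h => hy (hsupp (x := x) h).2, zero_mul, mul_zero]
    · rw [hA0 x hx, not_not.mp fun h => hx (hsupp (y := y) h).1, zero_mul, zero_mul]
  obtain ⟨c, d, hu, hv, huv⟩ := exists_unit_factors w hw_unit _ _ hprod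
  refine ⟨_, _, hu, hv, parityMatrix_mulVec_eq_or _ x₀ fun x hx => ?_,
    parityMatrix_mulVec_eq_or _ y₀ fun y hy => ?_, huv⟩
  · simp [hA0 x hx]
  · simp [hB0 y hy]
end
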